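/- (Wei–Gao–Yang) Let p be an odd prime and k a positive integer. In ℚ[x_1,x_2,x_3,…], the cycle index of the holomorph Hol(ℤ/p^kℤ) — i.e., (1/(p^{2k−1}(p−1)))·Σ_{a ∈ (ℤ/p^kℤ)ˣ} Σ_{b ∈ ℤ/p^kℤ} CT(λ(a,b)) — equals (1/(p^{2k−1}(p−1)))·[ Σ_{w=1}^{k} p^{2w−2}(p−1)·x_{p^w}^{p^{k−w}} + Σ_{w=0}^{k−1} φ(p^w)·p^w·x_1^{p^{k−w}}·∏_{u=1}^{w} x_{p^u}^{p^{k−w−1}(p−1)} + Σ_{w=0}^{k−1} Σ_{l ∣ p−1, l>1} p^k·φ(p^w)·φ(l)·x_1·x_l^{(p^{k−w}−1)/l}·∏_{u=1}^{w} x_{l·p^u}^{p^{k−1−w}(p−1)/l} ], where φ denotes Euler's totient function. -/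

import Mathlib

open MvPolynomial

/-- The affine permutation `λ(a,b) : x ↦ a·x + b` of `ZMod m`, for a unit `a` and an
element `b`. -/
def affinePerm (m : ℕ) (a : (ZMod m)ˣ) (b : ZMod m) : Equiv.Perm (ZMod m) where
  toFun x := (a : ZMod m) * x + b
  invFun x := ((a⁻¹ : (ZMod m)ˣ) : ZMod m) * (x - b)
  left_inv x := by
    show (a⁻¹ : (ZMod m)ˣ) * ((a : ZMod m) * x + b - b) = x
    rw [add_sub_cancel_right, ← mul_assoc, Units.inv_mul, one_mul]
  right_inv x := by
    show (a : ZMod m) * ((a⁻¹ : (ZMod m)ˣ) * (x - b)) + b = x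
    rw [← mul_assoc, Units.mul_inv, one_mul, sub_add_cancel]

/-- The number of cycles of length `ℓ` of a permutation `σ` of a finite set
(fixed points counting as cycles of length `1`). -/
noncomputable def cycCount {Λ : Type*} (σ : Equiv.Perm Λ) (ℓ : ℕ) : ℕ :=
  Nat.card {x : Λ // Function.minimalPeriod (fun y => σ y) x = ℓ} / ℓ

/-- The cycle type monomial `CT(σ) = ∏_ℓ x_ℓ^{c_ℓ(σ)}` of a permutation of a finite set,
as an element of `ℚ[x_1, x_2, …]` (variables indexed by `ℕ`). -/
noncomputable def CT {Λ : Type*} (σ : Equiv.Perm Λ) : MvPolynomial ℕ ℚ :=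
  ∏ ℓ ∈ Finset.Icc 1 (Nat.card Λ), (X ℓ) ^ cycCount σ ℓ

section CycleType

variable {Λ : Type*}

theorem minimalPeriod_eq_of_forall_dvd_iff {f : Λ → Λ} {x : Λ} {d : ℕ}
    (h : ∀ n, f^[n] x = x ↔ d ∣ n) : Function.minimalPeriod f x = d :=
  Nat.dvd_antisymm
    (Function.isPeriodicPt_iff_minimalPeriod_dvd.1 ((h d).2 dvd_rfl))
    ((h _).1 (Function.isPeriodicPt_minimalPeriod f x))

/-- The cycle type monomial as a product over any finite set of positive integers which
contains all the cycle lengths. -/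
theorem CT_eq_prod [Finite Λ] (σ : Equiv.Perm Λ) (S : Finset ℕ) (h0 : 0 ∉ S)
    (hS : ∀ x, Function.minimalPeriod (fun y => σ y) x ∈ S) :
    CT σ = ∏ ℓ ∈ S, (X ℓ : MvPolynomial ℕ ℚ) ^ cycCount σ ℓ := by
  classical
  have hI : CT σ = ∏ ℓ ∈ S ∪ Finset.Icc 1 (Nat.card Λ),
      (X ℓ : MvPolynomial ℕ ℚ) ^ cycCount σ ℓ := by
    refine Finset.prod_subset Finset.subset_union_right fun ℓ hℓ hℓ' => ?_
    have hlt : Nat.card Λ < ℓ := by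
      rcases Nat.eq_zero_or_pos ℓ with rfl | hpos
      · simp [h0] at hℓ
      · simp only [Finset.mem_Icc, not_and, not_le] at hℓ'
        exact hℓ' hpos
    rw [cycCount, Nat.div_eq_of_lt ((Finite.card_subtype_le _).trans_lt hlt), pow_zero]
  rw [hI]
  refine (Finset.prod_subset Finset.subset_union_left fun ℓ _ hℓ => ?_).symm
  have : IsEmpty {x : Λ // Function.minimalPeriod (fun y => σ y) x = ℓ} :=
    ⟨fun x => hℓ (x.2 ▸ hS x.1)⟩
  simp [cycCount]

end CycleType

section LiftingTheExponent

variable {p : ℕ}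

theorem emultiplicity_pow_sub_one (hp : p.Prime) (hodd : Odd p) {B : ℤ} (hB : (p : ℤ) ∣ B - 1)
    (m : ℕ) :
    emultiplicity (p : ℤ) (B ^ m - 1) = emultiplicity (p : ℤ) (B - 1) + emultiplicity p m := by
  have hpB : ¬ (p : ℤ) ∣ B := fun h => by
    have h1 : (p : ℤ) ∣ 1 := by simpa using dvd_sub h hB
    exact hp.one_lt.ne' (by exact_mod_cast Int.eq_one_of_dvd_one (by positivity) h1)
  simpa using Int.emultiplicity_pow_sub_pow hp hodd hB hpB m

theorem prime_pow_dvd_sub_one_iff (hp : p.Prime) (hodd : Odd p) {j k : ℕ} (hj : 0 < j)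
    (hjk : j ≤ k) (B : ℤ) :
    (p : ℤ) ^ j ∣ B - 1 ↔ (p : ℤ) ^ k ∣ B ^ p ^ (k - j) - 1 := by
  have : Fact p.Prime := ⟨hp⟩
  by_cases hB : (p : ℤ) ∣ B - 1
  · rw [pow_dvd_iff_le_emultiplicity, pow_dvd_iff_le_emultiplicity,
      emultiplicity_pow_sub_one hp hodd hB,
      emultiplicity_pow_self_of_prime hp.prime]
    cases emultiplicity (p : ℤ) (B - 1) with
    | top => simp
    | coe e => norm_cast; omega
  · refine iff_of_false (fun h => hB ((dvd_pow_self _ hj.ne').trans h)) fun h => hB ?_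
    have h1 := (dvd_pow_self (p : ℤ) (by omega : k ≠ 0)).trans h
    rw [← ZMod.intCast_zmod_eq_zero_iff_dvd] at h1 ⊢
    simpa [ZMod.pow_card_pow] using h1

theorem prime_pow_dvd_geom_sum_iff (hp : p.Prime) (hodd : Odd p) {A : ℤ} (hA : (p : ℤ) ∣ A - 1)
    (hA1 : A ≠ 1) (s n : ℕ) :
    (p : ℤ) ^ s ∣ ∑ i ∈ Finset.range n, A ^ i ↔ p ^ s ∣ n := by
  have h := emultiplicity_pow_sub_one hp hodd hA n
  rw [← geom_sum_mul, emultiplicity_mul (Nat.prime_iff_prime_int.1 hp), add_comm] at h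
  have hfin : emultiplicity (p : ℤ) (A - 1) ≠ ⊤ := finiteMultiplicity_iff_emultiplicity_ne_top.1
    (Int.finiteMultiplicity_iff.2 ⟨by simpa using hp.ne_one, sub_ne_zero.2 hA1⟩)
  rw [pow_dvd_iff_le_emultiplicity, pow_dvd_iff_le_emultiplicity,
    WithTop.add_left_cancel hfin h]

end LiftingTheExponent

section Iterates

variable {m : ℕ}

theorem affinePerm_apply (a : (ZMod m)ˣ) (b x : ZMod m) : affinePerm m a b x = a * x + b := rfl

theorem affinePerm_iterate_sub (a : (ZMod m)ˣ) (b x : ZMod m) (n : ℕ) :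
    (fun y => affinePerm m a b y)^[n] x - x
      = (∑ i ∈ Finset.range n, (a : ZMod m) ^ i) * ((a - 1) * x + b) := by
  induction n with
  | zero => simp
  | succ n ih =>
    rw [Function.iterate_succ_apply', affinePerm_apply, geom_sum_succ,
      sub_eq_iff_eq_add.1 ih]
    ring

theorem intCast_mul_eq_zero_iff (G : ℤ) (y : ZMod m) :
    (G : ZMod m) * y = 0 ↔ (addOrderOf y : ℤ) ∣ G := by
  rw [addOrderOf_dvd_iff_zsmul_eq_zero, zsmul_eq_mul]

end Iterates

section PrimePower

variable {p k : ℕ}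

/-- An integer representative, different from `1`, of a unit modulo `p ^ k`. -/
theorem exists_intCast_eq (hp : p.Prime) (a : (ZMod (p ^ k))ˣ) :
    ∃ A : ℤ, (A : ZMod (p ^ k)) = a ∧ A ≠ 1 := by
  obtain ⟨A, hA⟩ := ZMod.intCast_surjective (a : ZMod (p ^ k))
  by_cases h : A = 1
  · refine ⟨A + (p ^ k : ℕ), by
      rw [Int.cast_add, Int.cast_natCast, ZMod.natCast_self, hA, add_zero], ?_⟩
    have : 0 < p ^ k := pow_pos hp.pos k
    omega
  · exact ⟨A, hA, h⟩

theorem addOrderOf_eq_pow (hp : p.Prime) (z : ZMod (p ^ k)) :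
    ∃ j ≤ k, addOrderOf z = p ^ j := by
  refine (Nat.dvd_prime_pow hp).1 (addOrderOf_dvd_of_nsmul_eq_zero ?_)
  simp

theorem prime_pow_dvd_pow_sub_one_iff (hp : p.Prime) (hodd : Odd p) {a : (ZMod (p ^ k))ˣ}
    {A : ℤ} (hA : (A : ZMod (p ^ k)) = a) {l w : ℕ} (hl : l.Coprime p)
    (ha : orderOf a = l * p ^ w) {j : ℕ} (hj : 0 < j) (hjk : j ≤ k) (n : ℕ) :
    (p : ℤ) ^ j ∣ A ^ n - 1 ↔ l * p ^ (w - (k - j)) ∣ n := by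
  rw [prime_pow_dvd_sub_one_iff hp hodd hj hjk, ← pow_mul]
  have h1 : (p : ℤ) ^ k ∣ A ^ (n * p ^ (k - j)) - 1 ↔ orderOf a ∣ n * p ^ (k - j) := by
    rw [orderOf_dvd_iff_pow_eq_one, ← Units.val_inj, ← sub_eq_zero]
    have := ZMod.intCast_zmod_eq_zero_iff_dvd (A ^ (n * p ^ (k - j)) - 1) (p ^ k)
    push_cast at this
    rw [← this, hA]
    simp
  rw [h1, ha]
  rcases le_total (k - j) w with h | h
  · obtain ⟨u, rfl⟩ := Nat.exists_eq_add_of_le' h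
    rw [pow_add, ← mul_assoc, Nat.mul_dvd_mul_iff_right (pow_pos hp.pos _), Nat.add_sub_cancel]
  · rw [Nat.sub_eq_zero_of_le h, pow_zero, mul_one]
    refine ⟨fun h' => (hl.pow_right _).dvd_of_dvd_mul_right ((dvd_mul_right _ _).trans h'),
      fun h' => mul_dvd_mul h' (pow_dvd_pow _ h)⟩

/-- The cycle lengths of an affine permutation of `ZMod (p ^ k)` with a fixed point `c`. -/
theorem minimalPeriod_of_fixed (hp : p.Prime) (hodd : Odd p) {a : (ZMod (p ^ k))ˣ}
    {l w : ℕ} (hl : l.Coprime p) (ha : orderOf a = l * p ^ w) {b c : ZMod (p ^ k)}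
    (hc : a * c + b = c) {x : ZMod (p ^ k)} {j : ℕ} (hjk : j ≤ k)
    (hj : addOrderOf (x - c) = p ^ j) :
    Function.minimalPeriod (fun y => affinePerm (p ^ k) a b y) x
      = if j = 0 then 1 else l * p ^ (w - (k - j)) := by
  obtain ⟨A, hA, -⟩ := exists_intCast_eq hp a
  refine minimalPeriod_eq_of_forall_dvd_iff fun n => ?_
  have hb : ((a : ZMod (p ^ k)) - 1) * x + b = (a - 1) * (x - c) := by linear_combination hc
  have h1 : (fun y => affinePerm (p ^ k) a b y)^[n] x = x ↔ (p : ℤ) ^ j ∣ A ^ n - 1 := by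
    rw [← sub_eq_zero, affinePerm_iterate_sub, hb, ← mul_assoc, geom_sum_mul, ← hA]
    have := intCast_mul_eq_zero_iff (A ^ n - 1) (x - c)
    rw [hj] at this
    push_cast at this
    exact this
  rw [h1]
  split_ifs with h0
  · simp [h0]
  · exact prime_pow_dvd_pow_sub_one_iff hp hodd hA hl ha (Nat.pos_of_ne_zero h0) hjk n

/-- The cycle lengths of a fixed-point-free affine permutation of `ZMod (p ^ k)`. -/
theorem minimalPeriod_of_order_lt (hp : p.Prime) (hodd : Odd p) {a : (ZMod (p ^ k))ˣ}
    {w s : ℕ} (ha : orderOf a = p ^ w) (hws : w < s) (hsk : s ≤ k) {b : ZMod (p ^ k)}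
    (hb : addOrderOf b = p ^ s) (x : ZMod (p ^ k)) :
    Function.minimalPeriod (fun y => affinePerm (p ^ k) a b y) x = p ^ s := by
  have : Fact p.Prime := ⟨hp⟩
  obtain ⟨A, hA, hA1⟩ := exists_intCast_eq hp a
  have hdvd : (p : ℤ) ^ (k - w) ∣ A - 1 := by
    have := (prime_pow_dvd_pow_sub_one_iff hp hodd hA (l := 1) (Nat.coprime_one_left p)
      (by rw [ha, one_mul]) (j := k - w) (by omega) (by omega) 1).2
    rw [pow_one] at this
    exact this (by rw [Nat.sub_eq_zero_of_le (by omega)]; simp)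
  have htors : (p : ZMod (p ^ k)) ^ w * (a - 1) = 0 := by
    have h2 : ((p ^ k : ℕ) : ℤ) ∣ p ^ w * (A - 1) := by
      rw [show p ^ k = p ^ w * p ^ (k - w) by rw [← pow_add]; congr 1; omega]
      push_cast
      exact mul_dvd_mul_left _ hdvd
    rw [← ZMod.intCast_zmod_eq_zero_iff_dvd] at h2
    simpa [hA] using h2
  have hsmul : ∀ i, w ≤ i → p ^ i • (((a : ZMod (p ^ k)) - 1) * x + b) = p ^ i • b := by
    intro i hi
    obtain ⟨e, rfl⟩ := Nat.exists_eq_add_of_le hi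
    simp only [nsmul_eq_mul, pow_add]
    push_cast
    linear_combination (p : ZMod (p ^ k)) ^ e * x * htors
  have hord : addOrderOf (((a : ZMod (p ^ k)) - 1) * x + b) = p ^ s := by
    obtain ⟨s, rfl⟩ := Nat.exists_eq_succ_of_ne_zero (by omega : s ≠ 0)
    refine addOrderOf_eq_prime_pow ?_ ?_
    · rw [hsmul s (by omega), ← addOrderOf_dvd_iff_nsmul_eq_zero, hb,
        Nat.pow_dvd_pow_iff_le_right hp.one_lt]
      omega
    · rw [hsmul _ (by omega), ← addOrderOf_dvd_iff_nsmul_eq_zero, hb]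
  refine minimalPeriod_eq_of_forall_dvd_iff fun n => ?_
  rw [← sub_eq_zero, affinePerm_iterate_sub, ← hA]
  have := intCast_mul_eq_zero_iff (∑ i ∈ Finset.range n, A ^ i)
    (((a : ZMod (p ^ k)) - 1) * x + b)
  rw [hord] at this
  push_cast at this
  rw [← hA] at this
  rw [this, prime_pow_dvd_geom_sum_iff hp hodd
    ((dvd_pow_self _ (by omega : k - w ≠ 0)).trans hdvd) hA1]

theorem card_subtype_sub {m : ℕ} (c : ZMod m) {P Q : ZMod m → Prop}
    (h : ∀ x, P x ↔ Q (x - c)) : Nat.card {x // P x} = Nat.card {z // Q z} :=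
  Nat.card_congr ((Equiv.subRight c).subtypeEquiv h)

theorem card_addOrderOf_eq_totient (hp : p.Prime) {j : ℕ} (hj : j ≤ k) :
    Nat.card {z : ZMod (p ^ k) // addOrderOf z = p ^ j} = (p ^ j).totient := by
  classical
  have : NeZero (p ^ k) := ⟨(pow_pos hp.pos k).ne'⟩
  rw [Nat.card_eq_fintype_card, Fintype.card_subtype]
  exact IsAddCyclic.card_addOrderOf_eq_totient (by rw [ZMod.card]; exact pow_dvd_pow p hj)

theorem card_addOrderOf_dvd (hp : p.Prime) {j : ℕ} (hj : j ≤ k) :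
    Nat.card {z : ZMod (p ^ k) // addOrderOf z ∣ p ^ j} = p ^ j := by
  classical
  have : NeZero (p ^ k) := ⟨(pow_pos hp.pos k).ne'⟩
  rw [Nat.card_eq_fintype_card, Fintype.card_subtype]
  simp_rw [addOrderOf_dvd_iff_nsmul_eq_zero]
  rw [← sum_card_addOrderOf_eq_card_nsmul_eq_zero (pow_pos hp.pos j).ne']
  conv_rhs => rw [← Nat.sum_totient (p ^ j)]
  refine Finset.sum_congr rfl fun d hd => IsAddCyclic.card_addOrderOf_eq_totient ?_
  rw [ZMod.card]
  exact (Nat.dvd_of_mem_divisors hd).trans (pow_dvd_pow p hj)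

theorem card_addOrderOf_dvd_ne_zero (hp : p.Prime) {j : ℕ} (hj : j ≤ k) :
    Nat.card {z : ZMod (p ^ k) // addOrderOf z ∣ p ^ j ∧ z ≠ 0} = p ^ j - 1 := by
  classical
  have : NeZero (p ^ k) := ⟨(pow_pos hp.pos k).ne'⟩
  have h := card_addOrderOf_dvd hp hj
  rw [Nat.card_eq_fintype_card, Fintype.card_subtype] at h ⊢
  rw [Finset.filter_and_not, Finset.filter_eq' _ (0 : ZMod (p ^ k)),
    if_pos (Finset.mem_univ _), Finset.card_sdiff_of_subset (by simp), Finset.card_singleton, h]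

theorem minimalPeriod_eq_mul_pow_iff (hp : p.Prime) (hodd : Odd p) {a : (ZMod (p ^ k))ˣ} {l w : ℕ}
    (hl : l.Coprime p) (hwk : w < k) (ha : orderOf a = l * p ^ w) {b c : ZMod (p ^ k)}
    (hc : a * c + b = c)
    {u : ℕ} (hu : 0 < u) (x : ZMod (p ^ k)) :
    Function.minimalPeriod (fun y => affinePerm (p ^ k) a b y) x = l * p ^ u
      ↔ addOrderOf (x - c) = p ^ (k - w + u) := by
  have hl0 : 0 < l := by
    rcases Nat.eq_zero_or_pos l with rfl | h
    · exact absurd ((Nat.coprime_zero_left p).1 hl) hp.ne_one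
    · exact h
  obtain ⟨j, hjk, hj⟩ := addOrderOf_eq_pow hp (x - c)
  rw [minimalPeriod_of_fixed hp hodd hl ha hc hjk hj, hj, Nat.pow_right_inj hp.two_le]
  split_ifs with h0
  · refine iff_of_false (fun h => ?_) (by omega)
    exact (Nat.one_lt_pow hu.ne' hp.one_lt).ne' (Nat.eq_one_of_mul_eq_one_left h.symm)
  · rw [Nat.mul_right_inj hl0.ne', Nat.pow_right_inj hp.two_le]
    omega

theorem cycCount_mul_pow (hp : p.Prime) (hodd : Odd p) {a : (ZMod (p ^ k))ˣ} {l w : ℕ}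
    (hl : l.Coprime p) (hwk : w < k) (ha : orderOf a = l * p ^ w) {b c : ZMod (p ^ k)}
    (hc : a * c + b = c)
    {u : ℕ} (hu : 0 < u) (huw : u ≤ w) :
    cycCount (affinePerm (p ^ k) a b) (l * p ^ u) = p ^ (k - 1 - w) * (p - 1) / l := by
  rw [cycCount]
  rw [card_subtype_sub c (Q := fun z => addOrderOf z = p ^ (k - w + u))
      (minimalPeriod_eq_mul_pow_iff hp hodd hl hwk ha hc hu),
    card_addOrderOf_eq_totient hp (by omega),
    show k - w + u = (u + (k - 1 - w)) + 1 by omega, Nat.totient_prime_pow_succ hp, pow_add,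
    mul_assoc, mul_comm l, Nat.mul_div_mul_left _ _ (pow_pos hp.pos u)]

/-- The cycle type of an affine permutation with a fixed point and `p`-power order. -/
theorem CT_of_fixed_of_eq_one (hp : p.Prime) (hodd : Odd p) {a : (ZMod (p ^ k))ˣ} {l w : ℕ}
    (hl : l.Coprime p) (hwk : w < k) (ha : orderOf a = l * p ^ w) {b c : ZMod (p ^ k)}
    (hc : a * c + b = c)
    (hl1 : l = 1) :
    CT (affinePerm (p ^ k) a b) = X 1 ^ p ^ (k - w) *
      ∏ u ∈ Finset.Icc 1 w, (X (p ^ u) : MvPolynomial ℕ ℚ) ^ (p ^ (k - w - 1) * (p - 1)) := by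
  classical
  subst hl1
  have : NeZero (p ^ k) := ⟨(pow_pos hp.pos k).ne'⟩
  have hinj : Function.Injective (p ^ · : ℕ → ℕ) := Nat.pow_right_injective hp.two_le
  have hmem : 1 ∉ (Finset.Icc 1 w).image (p ^ ·) := by
    simp only [Finset.mem_image, Finset.mem_Icc, not_exists, not_and, and_imp]
    intro u hu _ h
    exact (Nat.one_lt_pow (by omega) hp.one_lt).ne' h
  rw [CT_eq_prod _ (insert 1 ((Finset.Icc 1 w).image (p ^ ·)))]
  · rw [Finset.prod_insert hmem, Finset.prod_image hinj.injOn]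
    congr 1
    · congr 1
      rw [cycCount, Nat.div_one, ← card_addOrderOf_dvd hp (by omega : k - w ≤ k)]
      refine card_subtype_sub c fun x => ?_
      obtain ⟨j, hjk, hj⟩ := addOrderOf_eq_pow hp (x - c)
      rw [minimalPeriod_of_fixed hp hodd hl ha hc hjk hj, hj,
        Nat.pow_dvd_pow_iff_le_right hp.one_lt]
      split_ifs with h0
      · simp [h0]
      · rw [one_mul, Nat.pow_eq_one]
        have := hp.ne_one
        omega
    · refine Finset.prod_congr rfl fun u hu => ?_
      rw [Finset.mem_Icc] at hu
      have h := cycCount_mul_pow hp hodd hl hwk ha hc hu.1 hu.2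
      rw [one_mul, Nat.div_one] at h
      rw [h, Nat.sub_right_comm]
  · simp [hp.ne_zero]
  · intro x
    obtain ⟨j, hjk, hj⟩ := addOrderOf_eq_pow hp (x - c)
    rw [minimalPeriod_of_fixed hp hodd hl ha hc hjk hj, one_mul]
    split_ifs with h0
    · simp
    · rcases Nat.eq_zero_or_pos (w - (k - j)) with h | h
      · simp [h]
      · exact Finset.mem_insert_of_mem (Finset.mem_image_of_mem _
          (Finset.mem_Icc.2 ⟨h, by omega⟩))

/-- The cycle type of an affine permutation with a fixed point whose order is not a power
of `p`. -/
theorem CT_of_fixed_of_one_lt (hp : p.Prime) (hodd : Odd p) {a : (ZMod (p ^ k))ˣ} {l w : ℕ}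
    (hl : l.Coprime p) (hwk : w < k) (ha : orderOf a = l * p ^ w) {b c : ZMod (p ^ k)}
    (hc : a * c + b = c)
    (hl1 : 1 < l) :
    CT (affinePerm (p ^ k) a b) = X 1 * X l ^ ((p ^ (k - w) - 1) / l) *
      ∏ u ∈ Finset.Icc 1 w,
        (X (l * p ^ u) : MvPolynomial ℕ ℚ) ^ (p ^ (k - 1 - w) * (p - 1) / l) := by
  classical
  have : NeZero (p ^ k) := ⟨(pow_pos hp.pos k).ne'⟩
  have hinj : Function.Injective (l * p ^ · : ℕ → ℕ) :=
    (mul_right_injective₀ (by omega)).comp (Nat.pow_right_injective hp.two_le)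
  have hmem : l ∉ (Finset.Icc 1 w).image (l * p ^ ·) := by
    simp only [Finset.mem_image, Finset.mem_Icc, not_exists, not_and, and_imp]
    intro u hu _ h
    exact (Nat.one_lt_pow (by omega) hp.one_lt).ne' ((Nat.mul_eq_left (by omega)).1 h)
  have hmem' : 1 ∉ insert l ((Finset.Icc 1 w).image (l * p ^ ·)) := by
    simp only [Finset.mem_insert, Finset.mem_image, not_or, not_exists, not_and]
    exact ⟨hl1.ne, fun u _ h => hl1.ne' (Nat.eq_one_of_mul_eq_one_right h)⟩
  have hperiod (x : ZMod (p ^ k)) {j : ℕ} (hj : addOrderOf (x - c) = p ^ j) :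
      j = 0 ↔ x - c = 0 := by
    rw [← AddMonoid.addOrderOf_eq_one_iff (x := x - c), hj, Nat.pow_eq_one]
    simp [hp.ne_one]
  rw [CT_eq_prod _ (insert 1 (insert l ((Finset.Icc 1 w).image (l * p ^ ·))))]
  · rw [Finset.prod_insert hmem', Finset.prod_insert hmem, Finset.prod_image hinj.injOn,
      mul_assoc]
    congr 1
    · rw [cycCount, Nat.div_one]
      suffices h : Nat.card {x // Function.minimalPeriod
          (fun y => affinePerm (p ^ k) a b y) x = 1} = 1 by rw [h, pow_one]
      have h1 : Nat.card {z : ZMod (p ^ k) // z = 0} = 1 := by simp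
      refine (card_subtype_sub c fun x => ?_).trans h1
      obtain ⟨j, hjk, hj⟩ := addOrderOf_eq_pow hp (x - c)
      rw [minimalPeriod_of_fixed hp hodd hl ha hc hjk hj, ← hperiod x hj]
      split_ifs with h0
      · simp [h0]
      · exact iff_of_false (fun h => hl1.ne' (Nat.eq_one_of_mul_eq_one_right h)) h0
    · congr 1
      · congr 1
        rw [cycCount, ← card_addOrderOf_dvd_ne_zero hp (by omega : k - w ≤ k)]
        congr 1
        refine card_subtype_sub c fun x => ?_
        obtain ⟨j, hjk, hj⟩ := addOrderOf_eq_pow hp (x - c)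
        rw [minimalPeriod_of_fixed hp hodd hl ha hc hjk hj, ne_eq, ← hperiod x hj, hj,
          Nat.pow_dvd_pow_iff_le_right hp.one_lt]
        split_ifs with h0
        · simp [h0, hl1.ne]
        · rw [Nat.mul_eq_left (by omega), Nat.pow_eq_one]
          have := hp.ne_one
          omega
      · refine Finset.prod_congr rfl fun u hu => ?_
        rw [Finset.mem_Icc] at hu
        rw [cycCount_mul_pow hp hodd hl hwk ha hc hu.1 hu.2]
  · have hl0 : l ≠ 0 := by omega
    simp [hp.ne_zero, hl0, hl0.symm]
  · intro x
    obtain ⟨j, hjk, hj⟩ := addOrderOf_eq_pow hp (x - c)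
    rw [minimalPeriod_of_fixed hp hodd hl ha hc hjk hj]
    split_ifs with h0
    · simp
    · refine Finset.mem_insert_of_mem ?_
      rcases Nat.eq_zero_or_pos (w - (k - j)) with h | h
      · simp [h]
      · exact Finset.mem_insert_of_mem (Finset.mem_image_of_mem _
          (Finset.mem_Icc.2 ⟨h, by omega⟩))

/-- The cycle type of a fixed-point-free affine permutation. -/
theorem CT_of_order_lt (hp : p.Prime) (hodd : Odd p) {a : (ZMod (p ^ k))ˣ}
    {w s : ℕ} (ha : orderOf a = p ^ w) (hws : w < s) (hsk : s ≤ k) {b : ZMod (p ^ k)}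
    (hb : addOrderOf b = p ^ s) :
    CT (affinePerm (p ^ k) a b) = (X (p ^ s) : MvPolynomial ℕ ℚ) ^ p ^ (k - s) := by
  have : NeZero (p ^ k) := ⟨(pow_pos hp.pos k).ne'⟩
  have h := minimalPeriod_of_order_lt hp hodd ha hws hsk hb
  rw [CT_eq_prod _ {p ^ s} (by simp [(pow_pos hp.pos s).ne]) (by simp [h]), Finset.prod_singleton,
    cycCount]
  simp [h, Nat.pow_div hsk hp.pos]

theorem exists_fixed_of_dvd (hp : p.Prime) {A B : ℤ} {e : ℕ} (h1 : (p : ℤ) ^ e ∣ A - 1)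
    (h2 : ¬ (p : ℤ) ^ (e + 1) ∣ A - 1) (h3 : (p : ℤ) ^ e ∣ B) :
    ∃ c : ZMod (p ^ k), A * c + B = c := by
  obtain ⟨m, hm⟩ := h1
  obtain ⟨B', rfl⟩ := h3
  have hpm : ¬ (p : ℤ) ∣ m := fun h => h2 (by
    rw [hm, pow_succ]
    exact mul_dvd_mul_left _ h)
  have hunit : IsUnit (m : ZMod (p ^ k)) := by
    rw [ZMod.coe_int_isUnit_iff_isCoprime, Nat.cast_pow]
    exact (((Nat.prime_iff_prime_int.1 hp).coprime_iff_not_dvd).2 hpm).pow_left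
  obtain ⟨c, hc⟩ := hunit.dvd (a := -(B' : ZMod (p ^ k)))
  refine ⟨c, ?_⟩
  have hA := congrArg (Int.cast : ℤ → ZMod (p ^ k)) hm
  push_cast at hA ⊢
  linear_combination c * hA - (p : ZMod (p ^ k)) ^ e * hc

theorem exists_fixed_of_one_lt (hp : p.Prime) (hodd : Odd p) {a : (ZMod (p ^ k))ˣ} {l w : ℕ}
    (hl : l.Coprime p) (hk : 0 < k) (ha : orderOf a = l * p ^ w) (hl1 : 1 < l)
    (b : ZMod (p ^ k)) : ∃ c, a * c + b = c := by
  obtain ⟨A, hA, -⟩ := exists_intCast_eq hp a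
  obtain ⟨B, rfl⟩ := ZMod.intCast_surjective b
  rw [← hA]
  refine exists_fixed_of_dvd hp (e := 0) (by simp) (fun h => ?_) (by simp)
  have h1 := (prime_pow_dvd_pow_sub_one_iff hp hodd hA hl ha one_pos (by omega) 1).1
    (by simpa using h)
  exact hl1.ne' (Nat.eq_one_of_mul_eq_one_right (Nat.dvd_one.1 h1))

theorem exists_fixed_of_order_le (hp : p.Prime) (hodd : Odd p) {a : (ZMod (p ^ k))ˣ}
    {w s : ℕ} (hwk : w < k) (ha : orderOf a = p ^ w) (hsw : s ≤ w) {b : ZMod (p ^ k)}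
    (hb : addOrderOf b = p ^ s) : ∃ c, a * c + b = c := by
  rcases Nat.eq_zero_or_pos w with rfl | hw
  · obtain rfl : s = 0 := by omega
    rw [pow_zero, orderOf_eq_one_iff] at ha
    rw [pow_zero, AddMonoid.addOrderOf_eq_one_iff] at hb
    exact ⟨0, by simp [hb]⟩
  obtain ⟨A, hA, -⟩ := exists_intCast_eq hp a
  obtain ⟨B, rfl⟩ := ZMod.intCast_surjective b
  have hdvd : ∀ j, 0 < j → j ≤ k → ((p : ℤ) ^ j ∣ A - 1 ↔ w - (k - j) = 0) := by
    intro j hj hjk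
    have h := prime_pow_dvd_pow_sub_one_iff hp hodd hA (Nat.coprime_one_left p)
      (by rw [ha, one_mul]) hj hjk 1
    rw [pow_one, one_mul, Nat.dvd_one, Nat.pow_eq_one] at h
    rw [h]
    have := hp.ne_one
    omega
  rw [← hA]
  refine exists_fixed_of_dvd hp (e := k - w) ((hdvd _ (by omega) (by omega)).2 (by omega))
    (fun h => ?_) ?_
  · have := (hdvd _ (by omega) (by omega)).1 h
    omega
  · have h1 : p ^ w • (B : ZMod (p ^ k)) = 0 := by
      rw [← addOrderOf_dvd_iff_nsmul_eq_zero, hb]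
      exact pow_dvd_pow p hsw
    have h2 : ((p ^ k : ℕ) : ℤ) ∣ p ^ w * B := by
      rw [← ZMod.intCast_zmod_eq_zero_iff_dvd]
      simpa using h1
    rw [show p ^ k = p ^ w * p ^ (k - w) by rw [← pow_add]; congr 1; omega] at h2
    push_cast at h2
    exact Int.dvd_of_mul_dvd_mul_left (pow_ne_zero _ (by exact_mod_cast hp.ne_zero)) h2

theorem sum_totient_prime_pow (hp : p.Prime) (w : ℕ) :
    ∑ s ∈ Finset.range (w + 1), (p ^ s).totient = p ^ w := by
  rw [← Nat.sum_divisors_prime_pow (f := Nat.totient) hp, Nat.sum_totient]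

theorem sum_CT_of_one_lt [NeZero (p ^ k)] (hp : p.Prime) (hodd : Odd p)
    {a : (ZMod (p ^ k))ˣ} {l w : ℕ}
    (hl : l.Coprime p) (hwk : w < k) (ha : orderOf a = l * p ^ w) (hl1 : 1 < l) :
    ∑ b : ZMod (p ^ k), CT (affinePerm (p ^ k) a b)
      = p ^ k • (X 1 * X l ^ ((p ^ (k - w) - 1) / l) *
      ∏ u ∈ Finset.Icc 1 w,
        (X (l * p ^ u) : MvPolynomial ℕ ℚ) ^ (p ^ (k - 1 - w) * (p - 1) / l)) := by
  rw [Finset.sum_congr rfl fun b _ => ?_, Finset.sum_const, Finset.card_univ, ZMod.card]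
  obtain ⟨c, hc⟩ := exists_fixed_of_one_lt hp hodd hl (by omega) ha hl1 b
  exact CT_of_fixed_of_one_lt hp hodd hl hwk ha hc hl1

theorem sum_CT_of_prime_pow [NeZero (p ^ k)] (hp : p.Prime) (hodd : Odd p)
    {a : (ZMod (p ^ k))ˣ} {w : ℕ} (hwk : w < k) (ha : orderOf a = p ^ w) :
    ∑ b : ZMod (p ^ k), CT (affinePerm (p ^ k) a b)
      = p ^ w • (X 1 ^ p ^ (k - w) *
          ∏ u ∈ Finset.Icc 1 w, (X (p ^ u) : MvPolynomial ℕ ℚ) ^ (p ^ (k - w - 1) * (p - 1)))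
        + ∑ s ∈ Finset.Ico (w + 1) (k + 1),
            (p ^ s).totient • (X (p ^ s) : MvPolynomial ℕ ℚ) ^ p ^ (k - s) := by
  have hcard : ∀ s ≤ k, Finset.card {b : ZMod (p ^ k) | addOrderOf b = p ^ s} = (p ^ s).totient :=
    fun s hs => IsAddCyclic.card_addOrderOf_eq_totient
      (by rw [ZMod.card]; exact pow_dvd_pow p hs)
  rw [← Finset.sum_fiberwise_of_maps_to (g := addOrderOf) (t := (p ^ k).divisors)
      (fun b _ => ?_), Nat.sum_divisors_prime_pow hp, Finset.range_eq_Ico,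
    ← Finset.sum_Ico_consecutive _ (Nat.zero_le (w + 1)) (by omega : w + 1 ≤ k + 1),
    ← Finset.range_eq_Ico]
  · congr 1
    · rw [← sum_totient_prime_pow hp w, Finset.sum_smul]
      refine Finset.sum_congr rfl fun s hs => ?_
      rw [Finset.mem_range] at hs
      rw [← hcard s (by omega), ← Finset.sum_const]
      refine Finset.sum_congr rfl fun b hb => ?_
      obtain ⟨c, hc⟩ := exists_fixed_of_order_le hp hodd hwk ha (by omega)
        (Finset.mem_filter.1 hb).2
      exact CT_of_fixed_of_eq_one hp hodd (Nat.coprime_one_left p) hwk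
        (by rw [ha, one_mul]) hc rfl
    · refine Finset.sum_congr rfl fun s hs => ?_
      rw [Finset.mem_Ico] at hs
      rw [← hcard s (by omega), ← Finset.sum_const]
      refine Finset.sum_congr rfl fun b hb => ?_
      exact CT_of_order_lt hp hodd ha (by omega) (by omega) (Finset.mem_filter.1 hb).2
  · obtain ⟨j, hj, h⟩ := addOrderOf_eq_pow hp b
    rw [h, Nat.mem_divisors]
    exact ⟨pow_dvd_pow p hj, NeZero.ne _⟩

theorem sum_divisors_mul_of_coprime {M : Type*} [AddCommMonoid M] {m n : ℕ}
    (hmn : m.Coprime n) (f : ℕ → M) :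
    ∑ d ∈ (m * n).divisors, f d = ∑ x ∈ m.divisors, ∑ y ∈ n.divisors, f (x * y) := by
  rw [Nat.divisors_mul, Finset.mul_def, Finset.sum_image hmn.mul_injOn_divisors,
    Finset.sum_product]

/-- Sorting the units modulo `p ^ k` by their orders `l * p ^ w`. -/
theorem sum_units_eq_sum_orderOf [NeZero (p ^ k)] (hp : p.Prime) (hk : 0 < k) {M : Type*}
    [AddCommMonoid M] (F : (ZMod (p ^ k))ˣ → M) :
    ∑ a, F a = ∑ w ∈ Finset.range k, ∑ l ∈ (p - 1).divisors,
      ∑ a with orderOf a = l * p ^ w, F a := by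
  have hcop : (p ^ (k - 1)).Coprime (p - 1) :=
    (Nat.coprime_self_sub_right hp.one_le |>.2 (Nat.coprime_one_right p)).pow_left _
  rw [← Finset.sum_fiberwise_of_maps_to (g := orderOf)
    (t := (p ^ (k - 1) * (p - 1)).divisors) (fun a _ => ?_), sum_divisors_mul_of_coprime hcop,
    Nat.sum_divisors_prime_pow hp, Nat.sub_add_cancel hk]
  · simp_rw [mul_comm]
  · rw [Nat.mem_divisors, ← Nat.totient_prime_pow hp hk]
    refine ⟨?_, (Nat.totient_pos.2 (pow_pos hp.pos k)).ne'⟩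
    rw [← ZMod.card_units_eq_totient]
    exact orderOf_dvd_card

theorem card_units_orderOf_eq [NeZero (p ^ k)] (hp : p.Prime) (hodd : Odd p) {l w : ℕ}
    (hwk : w < k) (hl : l ∣ p - 1) (hlp : l.Coprime p) :
    Finset.card {a : (ZMod (p ^ k))ˣ | orderOf a = l * p ^ w} = (p ^ w).totient * l.totient := by
  have := ZMod.isCyclic_units_of_prime_pow p hp (by rintro rfl; exact absurd hodd (by decide)) k
  rw [mul_comm, ← Nat.totient_mul (hlp.symm.pow_left w)]
  refine IsCyclic.card_orderOf_eq_totient ?_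
  rw [ZMod.card_units_eq_totient, Nat.totient_prime_pow hp (by omega)]
  exact mul_dvd_mul (pow_dvd_pow p (by omega)) hl

end PrimePower

/-- Wei–Gao–Yang: the cycle index of `Hol(ℤ/p^kℤ)` for an odd prime `p`. -/
theorem stmt13 (p : ℕ) (hp : p.Prime) (hodd : Odd p) (k : ℕ) (hk : 0 < k) :
    ((p : ℚ) ^ (2 * k - 1) * ((p : ℚ) - 1))⁻¹ •
        (∑ᶠ a : (ZMod (p ^ k))ˣ, ∑ᶠ b : ZMod (p ^ k), CT (affinePerm (p ^ k) a b))
      = ((p : ℚ) ^ (2 * k - 1) * ((p : ℚ) - 1))⁻¹ •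
        ((∑ w ∈ Finset.Icc 1 k,
            ((p ^ (2 * w - 2) * (p - 1) : ℕ) : ℚ) •
              ((X (p ^ w) : MvPolynomial ℕ ℚ) ^ (p ^ (k - w))))
          + (∑ w ∈ Finset.range k,
              ((Nat.totient (p ^ w) * p ^ w : ℕ) : ℚ) •
                ((X 1 : MvPolynomial ℕ ℚ) ^ (p ^ (k - w)) *
                  ∏ u ∈ Finset.Icc 1 w,
                    (X (p ^ u) : MvPolynomial ℕ ℚ) ^ (p ^ (k - w - 1) * (p - 1))))
          + (∑ w ∈ Finset.range k,
              ∑ l ∈ (p - 1).divisors.filter (fun l => 1 < l),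
                ((p ^ k * Nat.totient (p ^ w) * Nat.totient l : ℕ) : ℚ) •
                  ((X 1 : MvPolynomial ℕ ℚ) *
                    (X l : MvPolynomial ℕ ℚ) ^ ((p ^ (k - w) - 1) / l) *
                    ∏ u ∈ Finset.Icc 1 w,
                      (X (l * p ^ u) : MvPolynomial ℕ ℚ) ^
                        (p ^ (k - 1 - w) * (p - 1) / l)))) := by
  have : NeZero (p ^ k) := ⟨(pow_pos hp.pos k).ne'⟩
  have hcop : ∀ l ∈ (p - 1).divisors, l.Coprime p := fun l hl =>
    Nat.Coprime.coprime_dvd_left (Nat.dvd_of_mem_divisors hl)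
      ((Nat.coprime_self_sub_left hp.one_le).2 (Nat.coprime_one_left p))
  have hdiv : (p - 1).divisors = insert 1 ((p - 1).divisors.filter (1 < ·)) := by
    ext l
    have := hp.two_le
    rcases Nat.lt_trichotomy l 1 with h | h | h
    · simp [Nat.lt_one_iff.1 h]
    · simp [h]; omega
    · simp [h, h.ne']
  have hterm : ∀ w ∈ Finset.range k, ∀ l ∈ (p - 1).divisors.filter (1 < ·),
      ∑ a with orderOf a = l * p ^ w, ∑ b, CT (affinePerm (p ^ k) a b)
        = ((p ^ k * Nat.totient (p ^ w) * Nat.totient l : ℕ) : ℚ) •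
            ((X 1 : MvPolynomial ℕ ℚ) * X l ^ ((p ^ (k - w) - 1) / l) *
              ∏ u ∈ Finset.Icc 1 w, X (l * p ^ u) ^ (p ^ (k - 1 - w) * (p - 1) / l)) := by
    intro w hw l hl
    rw [Finset.mem_range] at hw
    rw [Finset.mem_filter] at hl
    rw [Finset.sum_congr rfl fun a ha => sum_CT_of_one_lt hp hodd (hcop l hl.1) hw
        (Finset.mem_filter.1 ha).2 hl.2, Finset.sum_const,
      card_units_orderOf_eq hp hodd hw (Nat.dvd_of_mem_divisors hl.1) (hcop l hl.1),
      smul_smul, Nat.cast_smul_eq_nsmul]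
    congr 1
    ring
  have hterm_one : ∀ w ∈ Finset.range k,
      ∑ a with orderOf a = 1 * p ^ w, ∑ b, CT (affinePerm (p ^ k) a b)
        = ((Nat.totient (p ^ w) * p ^ w : ℕ) : ℚ) •
            ((X 1 : MvPolynomial ℕ ℚ) ^ (p ^ (k - w)) *
              ∏ u ∈ Finset.Icc 1 w, X (p ^ u) ^ (p ^ (k - w - 1) * (p - 1)))
          + ∑ s ∈ Finset.Ico (w + 1) (k + 1),
            ((p ^ w).totient * (p ^ s).totient) •
              (X (p ^ s) : MvPolynomial ℕ ℚ) ^ p ^ (k - s) := by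
    intro w hw
    rw [Finset.mem_range] at hw
    rw [Finset.sum_congr rfl fun a ha => sum_CT_of_prime_pow hp hodd hw
        ((Finset.mem_filter.1 ha).2.trans (one_mul _)), Finset.sum_const,
      card_units_orderOf_eq hp hodd hw (one_dvd _) (Nat.coprime_one_left p),
      Nat.totient_one, mul_one, smul_add, smul_smul, Nat.cast_smul_eq_nsmul, Finset.smul_sum]
    simp_rw [smul_smul]
  have hfree : ∑ w ∈ Finset.range k, ∑ s ∈ Finset.Ico (w + 1) (k + 1),
        ((p ^ w).totient * (p ^ s).totient) • (X (p ^ s) : MvPolynomial ℕ ℚ) ^ p ^ (k - s)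
      = ∑ w ∈ Finset.Icc 1 k, ((p ^ (2 * w - 2) * (p - 1) : ℕ) : ℚ) •
          (X (p ^ w) : MvPolynomial ℕ ℚ) ^ p ^ (k - w) := by
    rw [Finset.sum_comm' (t' := Finset.Icc 1 k) (s' := fun s => Finset.range s)
      (fun w s => by simp only [Finset.mem_range, Finset.mem_Ico, Finset.mem_Icc]; omega)]
    refine Finset.sum_congr rfl fun s hs => ?_
    obtain ⟨t, rfl⟩ := Nat.exists_eq_succ_of_ne_zero
      (Nat.pos_iff_ne_zero.1 (Finset.mem_Icc.1 hs).1)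
    rw [← Finset.sum_smul, ← Finset.sum_mul, Nat.succ_eq_add_one, sum_totient_prime_pow hp,
      Nat.totient_prime_pow_succ hp, ← mul_assoc, ← pow_add, Nat.cast_smul_eq_nsmul,
      show 2 * (t + 1) - 2 = t + t by omega]
  congr 1
  simp_rw [finsum_eq_sum_of_fintype]
  rw [sum_units_eq_sum_orderOf hp hk, ← hfree, add_comm (∑ w ∈ Finset.range k, _),
    ← Finset.sum_add_distrib, ← Finset.sum_add_distrib]
  refine Finset.sum_congr rfl fun w hw => ?_
  rw [hdiv, Finset.sum_insert (by simp), hterm_one w hw, Finset.sum_congr rfl (hterm w hw),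
    ← hdiv]
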